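/- For a finite probabilistic automaton: (1) each strong i-depth bisimilarity ∼ⁱ (i > 1) is an equivalence relation; (2) ∼ʲ ⊆ ∼ⁱ whenever 1 ≤ i ≤ j; (3) there exists i ≥ 1 such that ∼ʲ = ∼ᵏ for all j, k ≥ i (the sequence stabilizes). -/

import Mathlib

open scoped Classical ENNReal
open MeasureTheory

noncomputable section

/-- A probabilistic automaton `(S, →, IS, AP, L)`.  The transition relation is given as a map
assigning to each state the (finite, nonempty) set of distributions it can move to.  (Totality
of the transition relation is the standard assumption making schedulers well defined.) -/
structure PA (S : Type) (AP : Type) where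
  trans : S → Set (PMF S)
  image_finite : ∀ s, (trans s).Finite
  nonempty_trans : ∀ s, (trans s).Nonempty
  init : Set S
  label : S → Set AP

/-- A (randomized) scheduler: maps every (nonempty) finite path to a distribution over
transitions, concentrated on transitions of the last state of the path. -/
structure Scheduler {S AP : Type} (P : PA S AP) where
  sched : List S → (S × PMF S) → ℝ≥0∞
  mass : ∀ ω : List S, ω ≠ [] → (∑' p : S × PMF S, sched ω p) = 1
  support_ok : ∀ (ω : List S) (p : S × PMF S), sched ω p ≠ 0 →
    ω.getLast? = some p.1 ∧ p.2 ∈ P.trans p.1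

/-- A deterministic scheduler: chooses, for every finite path, a single transition
(of the last state of the path). -/
structure DetSched {S AP : Type} (P : PA S AP) where
  choice : List S → PMF S
  mem : ∀ (ω : List S) (s : S), ω.getLast? = some s → choice ω ∈ P.trans s

variable {S AP : Type}

/-- Probability that a (sub)distribution assigns to a set of states. -/
def distProb (μ : S → ℝ≥0∞) (C : Set S) : ℝ≥0∞ := ∑' t, C.indicator μ t

/-- The cone of a finite path: all infinite paths extending it. -/
def Cone (ω : List S) : Set (ℕ → S) :=
  {π | ∀ (j : ℕ) (h : j < ω.length), π j = ω.get ⟨j, h⟩}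

/-- `π` is a path of the automaton `P`. -/
def ValidPath (P : PA S AP) (π : ℕ → S) : Prop :=
  ∀ i : ℕ, ∃ μ ∈ P.trans (π i), μ (π (i + 1)) ≠ 0

/-- Auxiliary function computing the weight of a cone: `cur` is the current state,
`pre` the finite path traversed so far (ending in `cur`), and the last argument the
remaining states to be visited. -/
def coneW (P : PA S AP) (σ : Scheduler P) : S → List S → List S → ℝ≥0∞
  | _, _, [] => 1
  | cur, pre, t :: rest =>
      (∑' μ : PMF S, σ.sched pre (cur, μ) * μ t) * coneW P σ t (pre ++ [t]) rest

/-- The probability `μ_{σ,s₀}(C_ω)` of the cone of the finite path `ω`. -/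
def coneWeight (P : PA S AP) (σ : Scheduler P) : List S → ℝ≥0∞
  | [] => 0
  | s :: rest => coneW P σ s [s] rest

/-- Premeasure on cones of finite paths starting at `s` (≠-cones get `∞`, the empty set `0`). -/
def preW (P : PA S AP) (σ : Scheduler P) (s : S) (E : Set (ℕ → S)) : ℝ≥0∞ :=
  if E = ∅ then 0
  else ⨅ (ω : List S) (_ : E = Cone ω),
    if ω.head? = some s then coneWeight P σ ω else 0

theorem preW_empty (P : PA S AP) (σ : Scheduler P) (s : S) : preW P σ s ∅ = 0 :=
  if_pos rfl

/-- The measure `μ_{σ,s}` on the path space: the Carathéodory (outer) measure generated by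
the cone premeasure; on the σ-algebra generated by the cones this is the unique measure
determined by the cone weights. -/
def pathProb (P : PA S AP) (σ : Scheduler P) (s : S) (E : Set (ℕ → S)) : ℝ≥0∞ :=
  MeasureTheory.OuterMeasure.ofFunction (preW P σ s) (preW_empty P σ s) E


/-- Comparison operators `⋈ ∈ {<, >, ≤, ≥}`. -/
inductive PCmp : Type
  | lt | gt | le | ge

def PCmp.holds : PCmp → ℝ≥0∞ → ℝ≥0∞ → Prop
  | .lt, x, q => x < q
  | .gt, x, q => x > q
  | .le, x, q => x ≤ q
  | .ge, x, q => x ≥ q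

mutual
/-- State formulas (of the master syntax containing PCTL⁎ and all fragments used below):
`φ ::= a | φ∧φ | φ∨φ | ¬φ | P_{⋈q}(ψ)` with `q ∈ [0,1]`. -/
inductive SF (AP : Type) : Type
  | atom : AP → SF AP
  | and : SF AP → SF AP → SF AP
  | or : SF AP → SF AP → SF AP
  | neg : SF AP → SF AP
  | prob : PCmp → (q : ℝ≥0∞) → q ≤ 1 → PF AP → SF AP

/-- Path formulas: `ψ ::= φ | ψ∧ψ | ψ∨ψ | ¬ψ | Xψ | ψ U ψ | ψ U^{≤n} ψ`. -/
inductive PF (AP : Type) : Type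
  | state : SF AP → PF AP
  | and : PF AP → PF AP → PF AP
  | or : PF AP → PF AP → PF AP
  | neg : PF AP → PF AP
  | next : PF AP → PF AP
  | untl : PF AP → PF AP → PF AP
  | buntl : ℕ → PF AP → PF AP → PF AP
end

variable {S AP : Type}

def shiftPath (π : ℕ → S) (j : ℕ) : ℕ → S := fun n => π (n + j)

mutual
/-- Satisfaction of state formulas. -/
def SatS (P : PA S AP) : SF AP → S → Prop
  | .atom a, s => a ∈ P.label s
  | .and φ₁ φ₂, s => SatS P φ₁ s ∧ SatS P φ₂ s
  | .or φ₁ φ₂, s => SatS P φ₁ s ∨ SatS P φ₂ s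
  | .neg φ, s => ¬ SatS P φ s
  | .prob c q _ ψ, s => ∀ σ : Scheduler P,
      PCmp.holds c (pathProb P σ s {π | ValidPath P π ∧ π 0 = s ∧ SatP P ψ π}) q

/-- Satisfaction of path formulas (LTL style). -/
def SatP (P : PA S AP) : PF AP → (ℕ → S) → Prop
  | .state φ, π => SatS P φ (π 0)
  | .and ψ₁ ψ₂, π => SatP P ψ₁ π ∧ SatP P ψ₂ π
  | .or ψ₁ ψ₂, π => SatP P ψ₁ π ∨ SatP P ψ₂ π
  | .neg ψ, π => ¬ SatP P ψ π
  | .next ψ, π => SatP P ψ (shiftPath π 1)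
  | .untl ψ₁ ψ₂, π => ∃ j : ℕ, SatP P ψ₂ (shiftPath π j) ∧ ∀ k < j, SatP P ψ₁ (shiftPath π k)
  | .buntl n ψ₁ ψ₂, π => ∃ j ≤ n, SatP P ψ₂ (shiftPath π j) ∧ ∀ k < j, SatP P ψ₁ (shiftPath π k)
end

/-- Depth of an (until-free) path formula: maximal nesting of `X`. -/
def PF.depth : PF AP → ℕ
  | .state _ => 0
  | .and ψ₁ ψ₂ => max ψ₁.depth ψ₂.depth
  | .or ψ₁ ψ₂ => max ψ₁.depth ψ₂.depth
  | .neg ψ => ψ.depth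
  | .next ψ => ψ.depth + 1
  | .untl _ _ => 0
  | .buntl _ _ _ => 0

/-! ### Membership predicates for the various logics -/

mutual
/-- State formulas of the PCTL-family of logics.  `aX`: is the next operator allowed;
`aU`: is unbounded until allowed; `bu n`: is bounded until with bound `n` allowed.
No disjunction (it is not part of the official PCTL syntax). -/
inductive SFmem (aX aU : Prop) (bu : ℕ → Prop) : ∀ {AP : Type}, SF AP → Prop
  | atom {AP : Type} (a : AP) : SFmem aX aU bu (.atom a)
  | and {AP : Type} {φ₁ φ₂ : SF AP} :
      SFmem aX aU bu φ₁ → SFmem aX aU bu φ₂ → SFmem aX aU bu (.and φ₁ φ₂)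
  | neg {AP : Type} {φ : SF AP} : SFmem aX aU bu φ → SFmem aX aU bu (.neg φ)
  | prob {AP : Type} {c : PCmp} {q : ℝ≥0∞} {h : q ≤ 1} {ψ : PF AP} :
      PFmem aX aU bu ψ → SFmem aX aU bu (.prob c q h ψ)

/-- Path formulas of the PCTL-family: `Xφ`, `φ₁ U φ₂`, `φ₁ U^{≤n} φ₂`. -/
inductive PFmem (aX aU : Prop) (bu : ℕ → Prop) : ∀ {AP : Type}, PF AP → Prop
  | next {AP : Type} {φ : SF AP} : aX → SFmem aX aU bu φ → PFmem aX aU bu (.next (.state φ))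
  | untl {AP : Type} {φ₁ φ₂ : SF AP} : aU → SFmem aX aU bu φ₁ → SFmem aX aU bu φ₂ →
      PFmem aX aU bu (.untl (.state φ₁) (.state φ₂))
  | buntl {AP : Type} {φ₁ φ₂ : SF AP} (n : ℕ) : bu n → SFmem aX aU bu φ₁ → SFmem aX aU bu φ₂ →
      PFmem aX aU bu (.buntl n (.state φ₁) (.state φ₂))
end

mutual
/-- State formulas of the PCTL⁎-family of logics. `aX`: next allowed; `aU`: until allowed;
`cap d`: the depth `d` of a path formula attached to a `P` operator is admissible. -/
inductive SFstarMem (aX aU : Prop) (cap : ℕ → Prop) : ∀ {AP : Type}, SF AP → Prop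
  | atom {AP : Type} (a : AP) : SFstarMem aX aU cap (.atom a)
  | and {AP : Type} {φ₁ φ₂ : SF AP} :
      SFstarMem aX aU cap φ₁ → SFstarMem aX aU cap φ₂ → SFstarMem aX aU cap (.and φ₁ φ₂)
  | neg {AP : Type} {φ : SF AP} : SFstarMem aX aU cap φ → SFstarMem aX aU cap (.neg φ)
  | prob {AP : Type} {c : PCmp} {q : ℝ≥0∞} {h : q ≤ 1} {ψ : PF AP} :
      PFstarMem aX aU cap ψ → cap ψ.depth → SFstarMem aX aU cap (.prob c q h ψ)

/-- Path formulas of the PCTL⁎-family: `φ | ψ∧ψ | ¬ψ | Xψ | ψ U ψ` (no bounded until). -/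
inductive PFstarMem (aX aU : Prop) (cap : ℕ → Prop) : ∀ {AP : Type}, PF AP → Prop
  | state {AP : Type} {φ : SF AP} : SFstarMem aX aU cap φ → PFstarMem aX aU cap (.state φ)
  | and {AP : Type} {ψ₁ ψ₂ : PF AP} :
      PFstarMem aX aU cap ψ₁ → PFstarMem aX aU cap ψ₂ → PFstarMem aX aU cap (.and ψ₁ ψ₂)
  | neg {AP : Type} {ψ : PF AP} : PFstarMem aX aU cap ψ → PFstarMem aX aU cap (.neg ψ)
  | next {AP : Type} {ψ : PF AP} : aX → PFstarMem aX aU cap ψ → PFstarMem aX aU cap (.next ψ)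
  | untl {AP : Type} {ψ₁ ψ₂ : PF AP} : aU → PFstarMem aX aU cap ψ₁ → PFstarMem aX aU cap ψ₂ →
      PFstarMem aX aU cap (.untl ψ₁ ψ₂)
end

mutual
/-- State formulas of the safe PCTL-family: `a | ¬a | φ∧φ | φ∨φ | P_{≥q}(ψ)`. -/
inductive SFsafeMem (aX aU : Prop) (bu : ℕ → Prop) : ∀ {AP : Type}, SF AP → Prop
  | atom {AP : Type} (a : AP) : SFsafeMem aX aU bu (.atom a)
  | natom {AP : Type} (a : AP) : SFsafeMem aX aU bu (.neg (.atom a))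
  | and {AP : Type} {φ₁ φ₂ : SF AP} :
      SFsafeMem aX aU bu φ₁ → SFsafeMem aX aU bu φ₂ → SFsafeMem aX aU bu (.and φ₁ φ₂)
  | or {AP : Type} {φ₁ φ₂ : SF AP} :
      SFsafeMem aX aU bu φ₁ → SFsafeMem aX aU bu φ₂ → SFsafeMem aX aU bu (.or φ₁ φ₂)
  | prob {AP : Type} {q : ℝ≥0∞} {h : q ≤ 1} {ψ : PF AP} :
      PFsafeMem aX aU bu ψ → SFsafeMem aX aU bu (.prob .ge q h ψ)

/-- Path formulas of the safe PCTL-family: `Xφ`, `φ₁ U φ₂`, `φ₁ U^{≤n} φ₂`. -/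
inductive PFsafeMem (aX aU : Prop) (bu : ℕ → Prop) : ∀ {AP : Type}, PF AP → Prop
  | next {AP : Type} {φ : SF AP} : aX → SFsafeMem aX aU bu φ →
      PFsafeMem aX aU bu (.next (.state φ))
  | untl {AP : Type} {φ₁ φ₂ : SF AP} : aU → SFsafeMem aX aU bu φ₁ → SFsafeMem aX aU bu φ₂ →
      PFsafeMem aX aU bu (.untl (.state φ₁) (.state φ₂))
  | buntl {AP : Type} {φ₁ φ₂ : SF AP} (n : ℕ) : bu n → SFsafeMem aX aU bu φ₁ →
      SFsafeMem aX aU bu φ₂ → PFsafeMem aX aU bu (.buntl n (.state φ₁) (.state φ₂))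
end

mutual
/-- State formulas of the safe PCTL⁎-family: `a | ¬a | φ∧φ | φ∨φ | P_{≥q}(ψ)`. -/
inductive SFsafeStarMem (aX aU : Prop) (cap : ℕ → Prop) : ∀ {AP : Type}, SF AP → Prop
  | atom {AP : Type} (a : AP) : SFsafeStarMem aX aU cap (.atom a)
  | natom {AP : Type} (a : AP) : SFsafeStarMem aX aU cap (.neg (.atom a))
  | and {AP : Type} {φ₁ φ₂ : SF AP} : SFsafeStarMem aX aU cap φ₁ → SFsafeStarMem aX aU cap φ₂ →
      SFsafeStarMem aX aU cap (.and φ₁ φ₂)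
  | or {AP : Type} {φ₁ φ₂ : SF AP} : SFsafeStarMem aX aU cap φ₁ → SFsafeStarMem aX aU cap φ₂ →
      SFsafeStarMem aX aU cap (.or φ₁ φ₂)
  | prob {AP : Type} {q : ℝ≥0∞} {h : q ≤ 1} {ψ : PF AP} :
      PFsafeStarMem aX aU cap ψ → cap ψ.depth → SFsafeStarMem aX aU cap (.prob .ge q h ψ)

/-- Path formulas of the safe PCTL⁎-family: `φ | ψ∧ψ | ψ∨ψ | Xψ | ψ U ψ`. -/
inductive PFsafeStarMem (aX aU : Prop) (cap : ℕ → Prop) : ∀ {AP : Type}, PF AP → Prop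
  | state {AP : Type} {φ : SF AP} : SFsafeStarMem aX aU cap φ →
      PFsafeStarMem aX aU cap (.state φ)
  | and {AP : Type} {ψ₁ ψ₂ : PF AP} : PFsafeStarMem aX aU cap ψ₁ → PFsafeStarMem aX aU cap ψ₂ →
      PFsafeStarMem aX aU cap (.and ψ₁ ψ₂)
  | or {AP : Type} {ψ₁ ψ₂ : PF AP} : PFsafeStarMem aX aU cap ψ₁ → PFsafeStarMem aX aU cap ψ₂ →
      PFsafeStarMem aX aU cap (.or ψ₁ ψ₂)
  | next {AP : Type} {ψ : PF AP} : aX → PFsafeStarMem aX aU cap ψ →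
      PFsafeStarMem aX aU cap (.next ψ)
  | untl {AP : Type} {ψ₁ ψ₂ : PF AP} : aU → PFsafeStarMem aX aU cap ψ₁ →
      PFsafeStarMem aX aU cap ψ₂ → PFsafeStarMem aX aU cap (.untl ψ₁ ψ₂)
end

/-- PCTL. -/
def inPCTL : SF AP → Prop := SFmem True True (fun _ => True)
/-- PCTL⁻ (PCTL without unbounded until). -/
def inPCTLminus : SF AP → Prop := SFmem True False (fun _ => True)
/-- PCTL⁻ᵢ (PCTL⁻ with bounded untils of bound at most `i`). -/
def inPCTLminusI (i : ℕ) : SF AP → Prop := SFmem True False (fun j => j ≤ i)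
/-- PCTL∖X (PCTL without next and without bounded until). -/
def inPCTLnoX : SF AP → Prop := SFmem False True (fun _ => False)
/-- PCTL⁎. -/
def inPCTLstar : SF AP → Prop := SFstarMem True True (fun _ => True)
/-- PCTL⁎⁻ (PCTL⁎ without until). -/
def inPCTLstarMinus : SF AP → Prop := SFstarMem True False (fun _ => True)
/-- PCTL⁎⁻ᵢ (PCTL⁎⁻ with path formulas of depth at most `i`). -/
def inPCTLstarMinusI (i : ℕ) : SF AP → Prop := SFstarMem True False (fun d => d ≤ i)
/-- PCTL⁎∖X (PCTL⁎ without next). -/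
def inPCTLstarNoX : SF AP → Prop := SFstarMem False True (fun _ => True)
/-- PCTL_s (safe fragment of PCTL). -/
def inPCTLsafe : SF AP → Prop := SFsafeMem True True (fun _ => True)
/-- PCTL⁻_s. -/
def inPCTLminusSafe : SF AP → Prop := SFsafeMem True False (fun _ => True)
/-- PCTL⁻_{i,s}. -/
def inPCTLminusSafeI (i : ℕ) : SF AP → Prop := SFsafeMem True False (fun j => j ≤ i)
/-- PCTL∖X,s (safe fragment of PCTL without next and bounded until). -/
def inPCTLnoXsafe : SF AP → Prop := SFsafeMem False True (fun _ => False)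
/-- PCTL⁎_s (safe fragment of PCTL⁎). -/
def inPCTLstarSafe : SF AP → Prop := SFsafeStarMem True True (fun _ => True)
/-- PCTL⁎⁻_s. -/
def inPCTLstarMinusSafe : SF AP → Prop := SFsafeStarMem True False (fun _ => True)
/-- PCTL⁎⁻_{i,s}. -/
def inPCTLstarMinusSafeI (i : ℕ) : SF AP → Prop := SFsafeStarMem True False (fun d => d ≤ i)

/-- Logical equivalence `s ≈_L r`: `s` and `r` satisfy the same formulas of the logic `L`. -/
def LEq (P : PA S AP) (L : SF AP → Prop) (s r : S) : Prop :=
  ∀ φ : SF AP, L φ → (SatS P φ s ↔ SatS P φ r)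

/-- Logical simulation order `s ⊑_L r`: every (safe) `L`-formula of `r` holds in `s`. -/
def LLe (P : PA S AP) (L : SF AP → Prop) (s r : S) : Prop :=
  ∀ φ : SF AP, L φ → (SatS P φ r → SatS P φ s)

/-! ### Transitions, combined transitions, interleaving -/

/-- Combined transition `s ⇒_P μ`: a convex combination of transitions of `s`. -/
def Combined (P : PA S AP) (s : S) (μ : S → ℝ≥0∞) : Prop :=
  ∃ (n : ℕ) (p : Fin n → ℝ≥0∞) (ν : Fin n → PMF S),
    (∀ k, ν k ∈ P.trans s) ∧ (∑ k, p k) = 1 ∧ ∀ t, μ t = ∑ k, p k * (ν k) t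

/-- The interleaving composition of two probabilistic automata. -/
def interleave {S₁ AP₁ S₂ AP₂ : Type} (P₁ : PA S₁ AP₁) (P₂ : PA S₂ AP₂) :
    PA (S₁ × S₂) (AP₁ × AP₂) where
  trans := fun p =>
    ((fun μ₁ => μ₁.map (fun a => (a, p.2))) '' P₁.trans p.1) ∪
    ((fun μ₂ => μ₂.map (fun b => (p.1, b))) '' P₂.trans p.2)
  image_finite := fun p =>
    ((P₁.image_finite p.1).image _).union ((P₂.image_finite p.2).image _)
  nonempty_trans := fun p => by
    obtain ⟨μ, hμ⟩ := P₁.nonempty_trans p.1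
    exact ⟨_, Or.inl ⟨μ, hμ, rfl⟩⟩
  init := P₁.init ×ˢ P₂.init
  label := fun p => (P₁.label p.1) ×ˢ (P₂.label p.2)

/-! ### Strong probabilistic (bi)simulation (Segala) -/

/-- `R` is a strong probabilistic bisimulation. -/
def IsSPB (P : PA S AP) (R : S → S → Prop) : Prop :=
  Equivalence R ∧
  ∀ s r, R s r → P.label s = P.label r ∧
    ∀ μ ∈ P.trans s, ∃ μ' : S → ℝ≥0∞, Combined P r μ' ∧
      ∀ u : S, distProb (⇑μ) {t | R t u} = distProb μ' {t | R t u}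

/-- Strong probabilistic bisimilarity `s ∼_P r`. -/
def SPBisim (P : PA S AP) (s r : S) : Prop := ∃ R, IsSPB P R ∧ R s r

/-- A weight function for `μ, ν` with respect to `R` exists (`μ ⊑_R ν`). -/
def WeightFn (R : S → S → Prop) (μ ν : S → ℝ≥0∞) : Prop :=
  ∃ Δ : S → S → ℝ≥0∞, (∀ a b, Δ a b ≤ 1) ∧ (∀ a b, Δ a b ≠ 0 → R a b) ∧
    (∀ a, μ a = ∑' b, Δ a b) ∧ (∀ b, ν b = ∑' a, Δ a b)

/-- `R` is a strong probabilistic simulation. -/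
def IsSPSim (P : PA S AP) (R : S → S → Prop) : Prop :=
  ∀ s r, R s r → P.label s = P.label r ∧
    ∀ μ ∈ P.trans s, ∃ μ' : S → ℝ≥0∞, Combined P r μ' ∧ WeightFn R (⇑μ) μ'

/-- Strong probabilistic similarity `s ⊑_P r`. -/
def SPSim (P : PA S AP) (s r : S) : Prop := ∃ R, IsSPSim P R ∧ R s r

/-! ### Branching transitions and branching probabilistic (bi)simulation (Segala) -/

/-- The Dirac distribution as a function. -/
def dirac (s : S) : S → ℝ≥0∞ := fun t => if t = s then 1 else 0

/-- Branching transition `s ⇒_R μ`: `s` evolves into `μ` moving only inside its own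
`R`-equivalence class. -/
inductive BranchTrans (P : PA S AP) (R : S → S → Prop) : S → (S → ℝ≥0∞) → Prop
  | dirac (s : S) : BranchTrans P R s (dirac s)
  | step (s : S) (μ' : PMF S) (hμ : μ' ∈ P.trans s) (f : S → S → ℝ≥0∞)
      (hf : ∀ r, μ' r ≠ 0 → (R s r ∧ R r s) → BranchTrans P R r (f r)) :
      BranchTrans P R s (fun t =>
        (∑' r : S, if R s r ∧ R r s then μ' r * f r t else 0) +
        (if R s t ∧ R t s then 0 else μ' t))

/-- Branching combined transition `s ⇒_{R,P} μ`. -/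
def BranchCombined (P : PA S AP) (R : S → S → Prop) (s : S) (μ : S → ℝ≥0∞) : Prop :=
  ∃ (n : ℕ) (p : Fin n → ℝ≥0∞) (ν : Fin n → S → ℝ≥0∞),
    (∀ k, BranchTrans P R s (ν k)) ∧ (∑ k, p k) = 1 ∧ ∀ t, μ t = ∑ k, p k * ν k t

/-- `R` is a branching probabilistic bisimulation. -/
def IsBPB (P : PA S AP) (R : S → S → Prop) : Prop :=
  Equivalence R ∧
  ∀ s r, R s r → P.label s = P.label r ∧
    ∀ μ ∈ P.trans s, ∃ μ' : S → ℝ≥0∞, BranchCombined P R r μ' ∧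
      ∀ u : S, distProb (⇑μ) {t | R t u} = distProb μ' {t | R t u}

/-- Branching probabilistic bisimilarity `s ≈_b^P r`. -/
def BPBisim (P : PA S AP) (s r : S) : Prop := ∃ R, IsBPB P R ∧ R s r

/-- `R` is a branching probabilistic simulation. -/
def IsBPSim (P : PA S AP) (R : S → S → Prop) : Prop :=
  ∀ s r, R s r → P.label s = P.label r ∧
    ∀ μ ∈ P.trans s, ∃ μ' : S → ℝ≥0∞, BranchCombined P R r μ' ∧ WeightFn R (⇑μ) μ'

/-- Branching probabilistic similarity `s ⪯_b^P r`. -/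
def BPSim (P : PA S AP) (s r : S) : Prop := ∃ R, IsBPSim P R ∧ R s r

/-! ### Downward closed sets, reachability probabilities, cone sets -/

/-- `C` is downward closed with respect to (the preorder) `R`. -/
def DownClosed (R : S → S → Prop) (C : Set S) : Prop :=
  C = {s' | ∃ s ∈ C, R s' s}

/-- `C` is closed with respect to (the equivalence) `R`. -/
def RClosed (R : S → S → Prop) (C : Set S) : Prop :=
  ∀ s ∈ C, ∀ r, R s r → r ∈ C

/-- `μ_{σ,s}(C, C', n, ω)`: probability of reaching `C'` from `s` within `n` steps,
passing only through states of `C`, under the deterministic scheduler `d`; `ω` is the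
finite path traversed so far (ending in `s`). -/
def reachP (P : PA S AP) (d : DetSched P) (C C' : Set S) : ℕ → List S → S → ℝ≥0∞
  | 0, _, s => if s ∈ C' then 1 else 0
  | n + 1, ω, s =>
      if s ∈ C' then 1
      else if s ∈ C then ∑' t : S, (d.choice ω) t * reachP P d C C' n (ω ++ [t]) t
      else 0

/-- `μ_{σ,s}(C, C', ω)`: probability of eventually reaching `C'` from `s` through states
of `C`, under the deterministic scheduler `d` (the least fixed point of the defining
recursive equation, i.e. the supremum of the step-bounded approximations). -/
def reachPU (P : PA S AP) (d : DetSched P) (C C' : Set S) (ω : List S) (s : S) : ℝ≥0∞ :=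
  ⨆ n : ℕ, reachP P d C C' n ω s

/-- `Ω̃` is a set of `R`-downward closed paths: nonempty sequences of `R`-downward
closed sets. -/
def DCPathSet (R : S → S → Prop) (Om : Set (List (Set S))) : Prop :=
  ∀ Ω ∈ Om, Ω ≠ [] ∧ ∀ C ∈ Ω, DownClosed R C

/-- The finite path `ω` matches the sequence of sets `Ω` (pointwise membership,
same length). -/
def MatchPath (ω : List S) (Ω : List (Set S)) : Prop := List.Forall₂ (· ∈ ·) ω Ω

/-- `ω ∈ Ω̃`. -/
def MatchSet (ω : List S) (Om : Set (List (Set S))) : Prop := ∃ Ω ∈ Om, MatchPath ω Ω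

/-- Probability (under σ, from s) of the union of the cones of the finite paths in `A`:
the sum of the cone weights of the members of `A` having no proper prefix in `A`. -/
def minCoverProb (P : PA S AP) (σ : Scheduler P) (s : S) (A : Set (List S)) : ℝ≥0∞ :=
  ∑' ω : {ω : List S // ω ∈ A ∧ ∀ ω' : List S, ω' <+: ω → ω' ≠ ω → ω' ∉ A},
    if (ω : List S).head? = some s then coneWeight P σ ω else 0

/-- `μ_{σ,s}(C_{Ω̃})`, the probability of the set of downward closed cones `C_{Ω̃}`. -/
def coneSetProb (P : PA S AP) (σ : Scheduler P) (s : S) (Om : Set (List (Set S))) : ℝ≥0∞ :=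
  minCoverProb P σ s {ω | MatchSet ω Om}

/-- Stuttering matching: `ω ∈ C₀^{k₀} ⋯ C_{n-2}^{k_{n-2}} C_{n-1}` for some
`k₀, …, k_{n-2} ≥ 0`, where `Ω = C₀ ⋯ C_{n-1}`. -/
inductive StMatch : List S → List (Set S) → Prop
  | last {t : S} {C : Set S} : t ∈ C → StMatch [t] [C]
  | skip {ω : List S} {C : Set S} {Ω : List (Set S)} :
      StMatch ω Ω → StMatch ω (C :: Ω)
  | step {t : S} {ω : List S} {C : Set S} {Ω : List (Set S)} :
      t ∈ C → Ω ≠ [] → StMatch ω (C :: Ω) → StMatch (t :: ω) (C :: Ω)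

/-- `ω` belongs to the stuttering closure of `Ω̃`. -/
def StMatchSet (ω : List S) (Om : Set (List (Set S))) : Prop := ∃ Ω ∈ Om, StMatch ω Ω

/-- `μ_{σ,s}(C_{Ω̃_st})`. -/
def coneSetProbSt (P : PA S AP) (σ : Scheduler P) (s : S) (Om : Set (List (Set S))) : ℝ≥0∞ :=
  minCoverProb P σ s {ω | StMatchSet ω Om}

/-! ### The novel strong bisimulations -/

/-- `R` is a strong 1-depth bisimulation. -/
def IsS1B (P : PA S AP) (R : S → S → Prop) : Prop :=
  Reflexive R ∧ Transitive R ∧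
  ∀ s r, R s r → P.label s = P.label r ∧
    ∀ C : Set S, DownClosed R C →
      (∀ μ ∈ P.trans s, 0 < distProb (⇑μ) C →
        ∃ μ' ∈ P.trans r, distProb (⇑μ') C ≤ distProb (⇑μ) C) ∧
      (∀ μ ∈ P.trans r, 0 < distProb (⇑μ) C →
        ∃ μ' ∈ P.trans s, distProb (⇑μ') C ≤ distProb (⇑μ) C)

/-- Strong 1-depth bisimilarity `s ∼₁ r`. -/
def S1Bisim (P : PA S AP) (s r : S) : Prop := ∃ R, IsS1B P R ∧ R s r

/-- Strong `i`-depth branching bisimilarity `∼ⁱ_b` (`∼¹_b = ∼₁`). -/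
def SBBisim (P : PA S AP) : ℕ → S → S → Prop
  | 0 => fun _ _ => True
  | 1 => S1Bisim P
  | i + 2 => fun s r => ∃ R : S → S → Prop,
      (Reflexive R ∧ Transitive R ∧
        ∀ s' r', R s' r' →
          SBBisim P (i + 1) s' r' ∧
          ∀ C C' : Set S, DownClosed R C → DownClosed R C' →
            (∀ d : DetSched P, 0 < reachP P d C C' (i + 2) [s'] s' →
              ∃ d' : DetSched P,
                reachP P d' C C' (i + 2) [r'] r' ≤ reachP P d C C' (i + 2) [s'] s') ∧
            (∀ d : DetSched P, 0 < reachP P d C C' (i + 2) [r'] r' →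
              ∃ d' : DetSched P,
                reachP P d' C C' (i + 2) [s'] s' ≤ reachP P d C C' (i + 2) [r'] r')) ∧
      R s r

/-- Strong `i`-depth bisimilarity `∼ⁱ` (`∼¹ = ∼₁`). -/
def SBisim (P : PA S AP) : ℕ → S → S → Prop
  | 0 => fun _ _ => True
  | 1 => S1Bisim P
  | i + 2 => fun s r => ∃ R : S → S → Prop,
      (Reflexive R ∧ Transitive R ∧
        ∀ s' r', R s' r' →
          SBisim P (i + 1) s' r' ∧
          ∀ Om : Set (List (Set S)), DCPathSet R Om →
            (∀ Ω ∈ Om, Ω.length ≤ i + 2) → (∃ Ω ∈ Om, Ω.length = i + 2) →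
            (∀ σ : Scheduler P, 0 < coneSetProb P σ s' Om →
              ∃ σ' : Scheduler P, coneSetProb P σ' r' Om ≤ coneSetProb P σ s' Om) ∧
            (∀ σ : Scheduler P, 0 < coneSetProb P σ r' Om →
              ∃ σ' : Scheduler P, coneSetProb P σ' s' Om ≤ coneSetProb P σ r' Om)) ∧
      R s r

/-! ### Weak bisimulations -/

/-- `R` is a weak branching bisimulation. -/
def IsWBB (P : PA S AP) (R : S → S → Prop) : Prop :=
  Reflexive R ∧ Transitive R ∧
  ∀ s r, R s r → P.label s = P.label r ∧
    ∀ C C' : Set S, DownClosed R C → DownClosed R C' →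
      (∀ d : DetSched P, 0 < reachPU P d C C' [s] s →
        ∃ d' : DetSched P, reachPU P d' C C' [r] r ≤ reachPU P d C C' [s] s) ∧
      (∀ d : DetSched P, 0 < reachPU P d C C' [r] r →
        ∃ d' : DetSched P, reachPU P d' C C' [s] s ≤ reachPU P d C C' [r] r)

/-- Weak branching bisimilarity `s ≈_b r`. -/
def WBBisim (P : PA S AP) (s r : S) : Prop := ∃ R, IsWBB P R ∧ R s r

/-- `R` is a weak bisimulation. -/
def IsWB (P : PA S AP) (R : S → S → Prop) : Prop :=
  Reflexive R ∧ Transitive R ∧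
  ∀ s r, R s r → P.label s = P.label r ∧
    ∀ Om : Set (List (Set S)), DCPathSet R Om →
      (∀ σ : Scheduler P, 0 < coneSetProbSt P σ s Om →
        ∃ σ' : Scheduler P, coneSetProbSt P σ' r Om ≤ coneSetProbSt P σ s Om) ∧
      (∀ σ : Scheduler P, 0 < coneSetProbSt P σ r Om →
        ∃ σ' : Scheduler P, coneSetProbSt P σ' s Om ≤ coneSetProbSt P σ r Om)

/-- Weak bisimilarity `s ≈ r`. -/
def WBisim (P : PA S AP) (s r : S) : Prop := ∃ R, IsWB P R ∧ R s r

/-! ### The novel simulations -/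

/-- Strong `i`-depth branching similarity `⊑ⁱ_b` (`⊑⁰_b` is label equality). -/
def SBSim (P : PA S AP) : ℕ → S → S → Prop
  | 0 => fun s r => P.label s = P.label r
  | i + 1 => fun s r => ∃ R : S → S → Prop,
      (∀ s' r', R s' r' →
        SBSim P i s' r' ∧
        ∀ C C' : Set S, DownClosed R C → DownClosed R C' →
          ∀ d : DetSched P, 0 < reachP P d C C' (i + 1) [s'] s' →
            ∃ d' : DetSched P,
              reachP P d' C C' (i + 1) [r'] r' ≤ reachP P d C C' (i + 1) [s'] s') ∧
      R s r

/-- Strong `i`-depth similarity `⊑ⁱ` (`⊑⁰` is label equality). -/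
def SSim (P : PA S AP) : ℕ → S → S → Prop
  | 0 => fun s r => P.label s = P.label r
  | i + 1 => fun s r => ∃ R : S → S → Prop,
      (∀ s' r', R s' r' →
        SSim P i s' r' ∧
        ∀ Om : Set (List (Set S)), DCPathSet R Om →
          (∀ Ω ∈ Om, Ω.length ≤ i + 1) → (∃ Ω ∈ Om, Ω.length = i + 1) →
          ∀ σ : Scheduler P, 0 < coneSetProb P σ s' Om →
            ∃ σ' : Scheduler P, coneSetProb P σ' r' Om ≤ coneSetProb P σ s' Om) ∧
      R s r

/-- `R` is a weak branching simulation. -/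
def IsWBSim (P : PA S AP) (R : S → S → Prop) : Prop :=
  ∀ s r, R s r → P.label s = P.label r ∧
    ∀ C C' : Set S, DownClosed R C → DownClosed R C' →
      ∀ d : DetSched P, 0 < reachPU P d C C' [s] s →
        ∃ d' : DetSched P, reachPU P d' C C' [r] r ≤ reachPU P d C C' [s] s

/-- Weak branching similarity `s ⪯_b r`. -/
def WBSim (P : PA S AP) (s r : S) : Prop := ∃ R, IsWBSim P R ∧ R s r

/-! ### Lower envelopes of families of finitely additive probabilities -/

/-- `m` is the attained pointwise minimum of the finitely additive probabilities `v σ`. -/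
structure IsLowerEnvelope {ι α : Type*} (v : ι → Set α → ℝ≥0∞) (m : Set α → ℝ≥0∞) : Prop where
  univ : ∀ σ, v σ Set.univ = 1
  union : ∀ σ A B, Disjoint A B → v σ (A ∪ B) = v σ A + v σ B
  le : ∀ σ A, m A ≤ v σ A
  attained : ∀ A, ∃ σ, v σ A = m A

/-- A lower envelope which is zero-one valued on `F` in the strong sense that every member of
`F` or its complement has full value. -/
def IsZeroOne {α : Type*} (F : Set (Set α)) (m : Set α → ℝ≥0∞) : Prop :=
  ∀ C ∈ F, m C = 1 ∨ m Cᶜ = 1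

namespace IsLowerEnvelope

variable {ι κ α : Type*} {v : ι → Set α → ℝ≥0∞} {w : κ → Set α → ℝ≥0∞}
  {m m' : Set α → ℝ≥0∞} {F : Set (Set α)}

theorem add_compl (h : IsLowerEnvelope v m) (σ : ι) (A : Set α) : v σ A + v σ Aᶜ = 1 := by
  rw [← h.union σ A Aᶜ disjoint_compl_right, Set.union_compl_self, h.univ]

theorem apply_le_one (h : IsLowerEnvelope v m) (σ : ι) (A : Set α) : v σ A ≤ 1 :=
  h.add_compl σ A ▸ le_self_add

theorem le_one (h : IsLowerEnvelope v m) (A : Set α) : m A ≤ 1 := by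
  obtain ⟨σ, hσ⟩ := h.attained A
  exact hσ ▸ h.apply_le_one σ A

theorem apply_mono (h : IsLowerEnvelope v m) (σ : ι) {A B : Set α} (hAB : A ⊆ B) :
    v σ A ≤ v σ B := by
  rw [← Set.union_sdiff_cancel hAB, h.union σ A (B \ A) Set.disjoint_sdiff_right]
  exact le_self_add

theorem mono (h : IsLowerEnvelope v m) {A B : Set α} (hAB : A ⊆ B) : m A ≤ m B := by
  obtain ⟨σ, hσ⟩ := h.attained B
  exact hσ ▸ (h.le σ A).trans (h.apply_mono σ hAB)

theorem eq_zero_of_null (h : IsLowerEnvelope v m) {A : Set α} (hA : ∀ σ, v σ A = 0) :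
    m A = 0 := by
  obtain ⟨σ, hσ⟩ := h.attained A
  rw [← hσ, hA]

theorem compl_eq_one_iff (h : IsLowerEnvelope v m) {A : Set α} :
    m Aᶜ = 1 ↔ ∀ σ, v σ A = 0 := by
  constructor
  · intro hA σ
    have h1 : v σ Aᶜ = 1 := le_antisymm (h.apply_le_one σ _) (hA ▸ h.le σ _)
    have h2 := h.add_compl σ A
    rw [h1] at h2
    have h3 : v σ A + 1 = 0 + 1 := by rw [h2, zero_add]
    exact (ENNReal.add_left_inj ENNReal.one_ne_top).1 h3
  · intro hA
    obtain ⟨σ, hσ⟩ := h.attained Aᶜ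
    have := h.add_compl σ A
    rwa [hA, zero_add, hσ] at this

/-- If a set separates two lower envelopes that agree on all sets which are null for neither of
them, then the second one is zero-one valued. -/
theorem isZeroOne_of_separated (hv : IsLowerEnvelope v m) (hw : IsLowerEnvelope w m')
    (hcompl : ∀ A ∈ F, Aᶜ ∈ F) (hinter : ∀ A ∈ F, ∀ B ∈ F, A ∩ B ∈ F)
    (hF : ∀ A ∈ F, (∀ σ, v σ A = 0) ∨ (∀ σ, w σ A = 0) ∨ m A = m' A)
    {A : Set α} (hA : A ∈ F) (hwA : ∀ σ, w σ A = 0) (hmA : m A ≠ 0) :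
    (∀ σ, v σ Aᶜ = 0) ∧ IsZeroOne F m' := by
  have key : ∀ B ∈ F, Disjoint A B → (¬ ∀ σ, w σ B = 0) → (∀ σ, v σ B = 0) ∧ m' B = m A := by
    intro B hB hAB hwB
    have hU : A ∪ B ∈ F := by
      have := hcompl _ (hinter _ (hcompl _ hA) _ (hcompl _ hB))
      rwa [Set.compl_inter, compl_compl, compl_compl] at this
    have hwU : ∀ σ, w σ (A ∪ B) = w σ B := fun σ => by
      rw [hw.union σ A B hAB, hwA, zero_add]
    have hmU : m (A ∪ B) = m' (A ∪ B) := by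
      rcases hF _ hU with h | h | h
      · exact absurd (hv.eq_zero_of_null h) fun h0 =>
          hmA (le_antisymm (h0 ▸ hv.mono Set.subset_union_left) zero_le)
      · exact absurd (fun σ => hwU σ ▸ h σ) hwB
      · exact h
    have hm'U : m' (A ∪ B) = m' B := by
      apply le_antisymm
      · obtain ⟨σ, hσ⟩ := hw.attained B
        rw [← hσ, ← hwU]
        exact hw.le σ _
      · exact hw.mono Set.subset_union_right
    have hlt : m A + m B ≤ m' B := by
      rw [← hm'U, ← hmU]
      obtain ⟨σ, hσ⟩ := hv.attained (A ∪ B)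
      rw [← hσ, hv.union σ A B hAB]
      exact add_le_add (hv.le σ A) (hv.le σ B)
    have hvB : ∀ σ, v σ B = 0 := by
      rcases hF _ hB with h | h | h
      · exact h
      · exact absurd h hwB
      · rw [← h] at hlt
        have hfin : m B ≠ ⊤ := ne_top_of_le_ne_top ENNReal.one_ne_top (hv.le_one B)
        have h0 : m A + m B ≤ 0 + m B := by rwa [zero_add]
        exact absurd (le_antisymm ((ENNReal.add_le_add_iff_right hfin).1 h0) zero_le) hmA
    refine ⟨hvB, ?_⟩
    rw [← hm'U, ← hmU]
    apply le_antisymm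
    · obtain ⟨σ, hσ⟩ := hv.attained A
      rw [← hσ, ← add_zero (v σ A), ← hvB σ, ← hv.union σ A B hAB]
      exact hv.le σ _
    · exact hv.mono Set.subset_union_left
  have hm'Ac : m' Aᶜ = 1 := hw.compl_eq_one_iff.2 hwA
  obtain ⟨hvAc, hAc⟩ := key Aᶜ (hcompl A hA) disjoint_compl_right
    (fun h => by simp [hw.eq_zero_of_null h] at hm'Ac)
  refine ⟨hvAc, fun C hC => ?_⟩
  by_cases hn : ∀ σ, w σ (C ∩ Aᶜ) = 0
  · right
    refine hw.compl_eq_one_iff.2 fun σ => ?_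
    have hd : Disjoint (C ∩ A) (C ∩ Aᶜ) :=
      disjoint_compl_right.mono Set.inter_subset_right Set.inter_subset_right
    rw [← Set.inter_union_compl C A, hw.union σ _ _ hd, hn, add_zero]
    exact le_antisymm (hwA σ ▸ hw.apply_mono σ Set.inter_subset_right) zero_le
  · left
    have h1 := (key (C ∩ Aᶜ) (hinter _ hC _ (hcompl A hA))
      (disjoint_compl_right.mono_right Set.inter_subset_right) hn).2
    rw [← hAc, hm'Ac] at h1
    exact le_antisymm (hw.le_one C) (h1 ▸ hw.mono Set.inter_subset_left)

theorem isZeroOne_both_of_separated (hv : IsLowerEnvelope v m) (hw : IsLowerEnvelope w m')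
    (hcompl : ∀ A ∈ F, Aᶜ ∈ F) (hinter : ∀ A ∈ F, ∀ B ∈ F, A ∩ B ∈ F)
    (hF : ∀ A ∈ F, (∀ σ, v σ A = 0) ∨ (∀ σ, w σ A = 0) ∨ m A = m' A)
    {A : Set α} (hA : A ∈ F) (hwA : ∀ σ, w σ A = 0) (hmA : m A ≠ m' A) :
    IsZeroOne F m ∧ IsZeroOne F m' := by
  obtain ⟨h1, h2⟩ := hv.isZeroOne_of_separated hw hcompl hinter hF hA hwA
    (fun h => hmA (h.trans (hw.eq_zero_of_null hwA).symm))
  refine ⟨(hw.isZeroOne_of_separated hv hcompl hinter (fun B hB => ?_) (hcompl A hA) h1 ?_).2, h2⟩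
  · rcases hF B hB with h | h | h
    · exact Or.inr (Or.inl h)
    · exact Or.inl h
    · exact Or.inr (Or.inr h.symm)
  · rw [hw.compl_eq_one_iff.2 hwA]
    exact one_ne_zero

/-- Two lower envelopes that agree on all sets of `F` which are null for neither of them agree
on all of `F`, or both are zero-one valued. -/
theorem eq_or_isZeroOne (hv : IsLowerEnvelope v m) (hw : IsLowerEnvelope w m')
    (hcompl : ∀ A ∈ F, Aᶜ ∈ F) (hinter : ∀ A ∈ F, ∀ B ∈ F, A ∩ B ∈ F)
    (hF : ∀ A ∈ F, (∀ σ, v σ A = 0) ∨ (∀ σ, w σ A = 0) ∨ m A = m' A) :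
    (∀ A ∈ F, m A = m' A) ∨ (IsZeroOne F m ∧ IsZeroOne F m') := by
  by_cases h : ∀ A ∈ F, m A = m' A
  · exact Or.inl h
  right
  push Not at h
  obtain ⟨A, hA, hne⟩ := h
  rcases hF A hA with h | h | h
  · refine (hw.isZeroOne_both_of_separated hv hcompl hinter (fun B hB => ?_) hA h hne.symm).symm
    rcases hF B hB with h | h | h
    · exact Or.inr (Or.inl h)
    · exact Or.inl h
    · exact Or.inr (Or.inr h.symm)
  · exact hv.isZeroOne_both_of_separated hw hcompl hinter hF hA h hne
  · exact absurd h hne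

end IsLowerEnvelope

/-! ### Probabilities of sets of paths of a fixed length -/

variable {P : PA S AP}

/-- Probability that the scheduler `σ` moves from `s`, reached along `ω`, to `t`. -/
def stepProb (σ : Scheduler P) (ω : List S) (s t : S) : ℝ≥0∞ :=
  ∑' μ : PMF S, σ.sched ω (s, μ) * μ t

/-- Probability that the path `ω`, ending in `s`, is extended by `n` further states to a member
of `A`. -/
def pathVal (σ : Scheduler P) (A : Set (List S)) : ℕ → S → List S → ℝ≥0∞
  | 0, _, ω => if ω ∈ A then 1 else 0
  | n + 1, s, ω => ∑' t, stepProb σ ω s t * pathVal σ A n t (ω ++ [t])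

theorem tsum_sched (σ : Scheduler P) {ω : List S} {s : S} (h : ω.getLast? = some s) :
    ∑' μ, σ.sched ω (s, μ) = 1 := by
  rw [← σ.mass ω (by rintro rfl; simp at h), ENNReal.tsum_prod', tsum_eq_single s]
  intro t ht
  refine ENNReal.tsum_eq_zero.2 fun μ => ?_
  by_contra h0
  have := (σ.support_ok ω (t, μ) h0).1
  rw [h] at this
  exact ht (Option.some_injective _ this).symm

theorem tsum_stepProb_mul (σ : Scheduler P) (ω : List S) (s : S) (f : S → ℝ≥0∞) :
    ∑' t, stepProb σ ω s t * f t = ∑' μ : PMF S, σ.sched ω (s, μ) * ∑' t, μ t * f t := by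
  simp_rw [stepProb, ← ENNReal.tsum_mul_right]
  rw [ENNReal.tsum_comm]
  simp_rw [mul_assoc, ENNReal.tsum_mul_left]

theorem tsum_stepProb (σ : Scheduler P) {ω : List S} {s : S} (h : ω.getLast? = some s) :
    ∑' t, stepProb σ ω s t = 1 := by
  have := tsum_stepProb_mul σ ω s 1
  simpa [PMF.tsum_coe, tsum_sched σ h] using this

theorem pathVal_eq_one (σ : Scheduler P) {A : Set (List S)} {n : ℕ} {s : S} {ω : List S}
    (h : ω.getLast? = some s) (hA : ∀ l : List S, ω ++ l ∈ A) : pathVal σ A n s ω = 1 := by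
  induction n generalizing s ω with
  | zero => simpa [pathVal] using hA []
  | succ n ih =>
    rw [pathVal, ← tsum_stepProb σ h]
    refine tsum_congr fun t => ?_
    rw [ih (by simp) fun l => by simpa using hA (t :: l), mul_one]

theorem pathVal_congr (σ : Scheduler P) {A B : Set (List S)} {n : ℕ} {s : S} {ω : List S}
    (h : ∀ l : List S, l.length = n → (ω ++ l ∈ A ↔ ω ++ l ∈ B)) :
    pathVal σ A n s ω = pathVal σ B n s ω := by
  induction n generalizing s ω with
  | zero =>
    have := h [] rfl
    simp only [List.append_nil] at this
    simp [pathVal, this]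
  | succ n ih =>
    refine tsum_congr fun t => ?_
    rw [ih fun l hl => by simpa using h (t :: l) (by simp [hl])]

theorem pathVal_union (σ : Scheduler P) {A B : Set (List S)} (hAB : Disjoint A B) (n : ℕ) (s : S)
    (ω : List S) : pathVal σ (A ∪ B) n s ω = pathVal σ A n s ω + pathVal σ B n s ω := by
  induction n generalizing s ω with
  | zero =>
    by_cases hA : ω ∈ A
    · simp [pathVal, hA, Set.disjoint_left.1 hAB hA]
    · simp [pathVal, hA]
  | succ n ih => simp only [pathVal, ih, mul_add, ENNReal.tsum_add]

/-- The minimum of `pathVal` over all schedulers, computed by backward induction. -/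
def minVal (P : PA S AP) (A : Set (List S)) : ℕ → S → List S → ℝ≥0∞
  | 0, _, ω => if ω ∈ A then 1 else 0
  | n + 1, s, ω => ⨅ μ ∈ P.trans s, ∑' t, μ t * minVal P A n t (ω ++ [t])

theorem minVal_le_pathVal (σ : Scheduler P) (A : Set (List S)) {n : ℕ} {s : S} {ω : List S}
    (h : ω.getLast? = some s) : minVal P A n s ω ≤ pathVal σ A n s ω := by
  induction n generalizing s ω with
  | zero => exact le_rfl
  | succ n ih =>
    rw [pathVal, tsum_stepProb_mul, ← one_mul (minVal P A (n + 1) s ω), ← tsum_sched σ h,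
      ← ENNReal.tsum_mul_right]
    refine ENNReal.tsum_le_tsum fun μ => ?_
    by_cases hμ : σ.sched ω (s, μ) = 0
    · simp [hμ]
    · refine mul_le_mul_right ((iInf₂_le μ (σ.support_ok _ _ hμ).2).trans ?_) _
      exact ENNReal.tsum_le_tsum fun t => mul_le_mul_right (ih (by simp)) _

/-- A deterministic scheduler, seen as a randomized one. -/
def DetSched.toScheduler (d : DetSched P) : Scheduler P where
  sched ω p := if ω.getLast? = some p.1 ∧ p.2 = d.choice ω then 1 else 0
  mass ω hω := by
    rw [tsum_eq_single (ω.getLast hω, d.choice ω)]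
    · simp [List.getLast?_eq_some_getLast hω]
    · rintro ⟨s, μ⟩ hne
      refine if_neg ?_
      rintro ⟨h1, h2⟩
      rw [List.getLast?_eq_some_getLast hω] at h1
      exact hne (Prod.ext (Option.some_injective _ h1).symm h2)
  support_ok ω p hp := by
    have h : ω.getLast? = some p.1 ∧ p.2 = d.choice ω := by
      by_contra h
      exact hp (if_neg h)
    exact ⟨h.1, h.2 ▸ d.mem ω p.1 h.1⟩

theorem DetSched.stepProb_toScheduler (d : DetSched P) {ω : List S} {s : S}
    (h : ω.getLast? = some s) (t : S) : stepProb d.toScheduler ω s t = d.choice ω t := by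
  rw [stepProb, tsum_eq_single (d.choice ω)]
  · simp [DetSched.toScheduler, h]
  · intro μ hμ
    simp [DetSched.toScheduler, hμ]

/-- Any choice of a transition for each finite path and each state yields a scheduler. -/
theorem exists_scheduler_of_choice (P : PA S AP) (s₀ : S) (f : List S → S → PMF S)
    (hf : ∀ ω s, f ω s ∈ P.trans s) :
    ∃ σ : Scheduler P, ∀ ω s, ω.getLast? = some s → ∀ t, stepProb σ ω s t = f ω s t := by
  have hD : ∀ (ω : List S) (s : S), ω.getLast? = some s → ω.getLastD s₀ = s := by
    intro ω s h
    rw [List.getLastD_eq_getLast?, h, Option.getD_some]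
  let d : DetSched P := ⟨fun ω => f ω (ω.getLastD s₀), fun ω s h => by
    rw [hD ω s h]; exact hf ω s⟩
  refine ⟨d.toScheduler, fun ω s h t => ?_⟩
  rw [d.stepProb_toScheduler h, ← hD ω s h]

theorem exists_pathVal_eq_minVal (P : PA S AP) (A : Set (List S)) (n : ℕ) (s : S) :
    ∃ σ : Scheduler P, pathVal σ A n s [s] = minVal P A n s [s] := by
  let cost (ω : List S) (μ : PMF S) : ℝ≥0∞ :=
    ∑' t, μ t * minVal P A (n - ω.length) t (ω ++ [t])
  have hmin : ∀ (ω : List S) (u : S), ∃ μ ∈ P.trans u, ∀ ν ∈ P.trans u, cost ω μ ≤ cost ω ν :=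
    fun ω u => Set.exists_min_image _ (cost ω) (P.image_finite u) (P.nonempty_trans u)
  choose f hf hfmin using hmin
  obtain ⟨σ, hσ⟩ := exists_scheduler_of_choice P s f hf
  refine ⟨σ, ?_⟩
  have key : ∀ (m : ℕ) (u : S) (ω : List S), ω.getLast? = some u → ω.length + m = n + 1 →
      pathVal σ A m u ω = minVal P A m u ω := by
    intro m
    induction m with
    | zero => intros; rfl
    | succ m ih =>
      intro u ω hu hlen
      have hm : n - ω.length = m := by omega
      have hval : pathVal σ A (m + 1) u ω = cost ω (f ω u) := by
        refine tsum_congr fun t => ?_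
        rw [hσ ω u hu, ih t (ω ++ [t]) (by simp) (by simp; omega), hm]
      rw [hval]
      refine le_antisymm (le_iInf₂ fun μ hμ => ?_) ((iInf₂_le _ (hf ω u)).trans ?_)
      · exact (hfmin ω u μ hμ).trans (by simp only [cost, hm, le_refl])
      · simp only [cost, hm, le_refl]
  exact key n s [s] rfl (by simp; omega)

theorem isLowerEnvelope_minVal (P : PA S AP) (n : ℕ) (s : S) :
    IsLowerEnvelope (fun (σ : Scheduler P) A => pathVal σ A n s [s])
      (fun A => minVal P A n s [s]) where
  univ σ := pathVal_eq_one σ rfl fun _ => Set.mem_univ _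
  union σ _ _ h := pathVal_union σ h n s [s]
  le σ A := minVal_le_pathVal σ A rfl
  attained A := exists_pathVal_eq_minVal P A n s

/-- The scheduler that at each path follows `σ₁` with probability `c` and `σ₀` otherwise. -/
def Scheduler.mix (σ₀ σ₁ : Scheduler P) (c : ℝ≥0∞) (hc : c ≤ 1) : Scheduler P where
  sched ω p := (1 - c) * σ₀.sched ω p + c * σ₁.sched ω p
  mass ω hω := by
    rw [ENNReal.tsum_add, ENNReal.tsum_mul_left, ENNReal.tsum_mul_left, σ₀.mass ω hω,
      σ₁.mass ω hω, mul_one, mul_one, tsub_add_cancel_of_le hc]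
  support_ok ω p hp := by
    by_cases h : σ₀.sched ω p = 0
    · exact σ₁.support_ok ω p fun h' => hp (by simp [h, h'])
    · exact σ₀.support_ok ω p h

theorem stepProb_mix (σ₀ σ₁ : Scheduler P) (c : ℝ≥0∞) (hc : c ≤ 1) (ω : List S) (s t : S) :
    stepProb (σ₀.mix σ₁ c hc) ω s t = (1 - c) * stepProb σ₀ ω s t + c * stepProb σ₁ ω s t := by
  simp only [stepProb, Scheduler.mix, add_mul, mul_assoc, ENNReal.tsum_add, ENNReal.tsum_mul_left]

theorem pathVal_mix_le (σ₀ σ₁ : Scheduler P) (c : ℝ≥0∞) (hc : c ≤ 1) (A : Set (List S)) {n : ℕ}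
    {s : S} {ω : List S} (h : ω.getLast? = some s) :
    pathVal (σ₀.mix σ₁ c hc) A n s ω ≤ pathVal σ₀ A n s ω + n * c := by
  induction n generalizing s ω with
  | zero => exact le_self_add
  | succ n ih =>
    have h1 : ∀ t, pathVal (σ₀.mix σ₁ c hc) A n t (ω ++ [t]) ≤ 1 := fun t => by
      have hlast : (ω ++ [t]).getLast? = some t := by simp
      rw [← pathVal_eq_one (σ₀.mix σ₁ c hc) (A := Set.univ) (n := n) hlast fun _ => Set.mem_univ _,
        ← Set.union_compl_self A, pathVal_union _ disjoint_compl_right]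
      exact le_self_add
    calc pathVal (σ₀.mix σ₁ c hc) A (n + 1) s ω
        ≤ ∑' t, (stepProb σ₀ ω s t * (pathVal σ₀ A n t (ω ++ [t]) + n * c)
            + c * stepProb σ₁ ω s t) := by
          refine ENNReal.tsum_le_tsum fun t => ?_
          rw [stepProb_mix, add_mul]
          refine add_le_add (mul_le_mul' ?_ (ih (by simp))) ?_
          · exact mul_le_of_le_one_left zero_le tsub_le_self
          · exact mul_le_of_le_one_right zero_le (h1 t)
      _ = pathVal σ₀ A (n + 1) s ω + (n + 1 : ℕ) * c := by
          simp only [mul_add, ENNReal.tsum_add, ENNReal.tsum_mul_left, ENNReal.tsum_mul_right,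
            tsum_stepProb σ₀ h, tsum_stepProb σ₁ h, pathVal]
          push_cast
          ring

theorem pow_mul_pathVal_le_pathVal_mix (σ₀ σ₁ : Scheduler P) (c : ℝ≥0∞) (hc : c ≤ 1)
    (A : Set (List S)) (n : ℕ) (s : S) (ω : List S) :
    c ^ n * pathVal σ₁ A n s ω ≤ pathVal (σ₀.mix σ₁ c hc) A n s ω := by
  induction n generalizing s ω with
  | zero => simp [pathVal]
  | succ n ih =>
    rw [pathVal, ← ENNReal.tsum_mul_left, pathVal]
    refine ENNReal.tsum_le_tsum fun t => ?_
    calc c ^ (n + 1) * (stepProb σ₁ ω s t * pathVal σ₁ A n t (ω ++ [t]))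
        = (c * stepProb σ₁ ω s t) * (c ^ n * pathVal σ₁ A n t (ω ++ [t])) := by ring
      _ ≤ _ := mul_le_mul' (by rw [stepProb_mix]; exact le_add_self) (ih _ _)

/-- If each positive value at `s` is bounded below by some value at `r`, and some value at `s`
is positive, then the minimal value at `r` is at most the minimal value at `s`. -/
theorem minVal_le_minVal_of_forall_pos {A : Set (List S)} {n : ℕ} {s r : S}
    (h : ∀ σ : Scheduler P, 0 < pathVal σ A n s [s] →
      ∃ σ' : Scheduler P, pathVal σ' A n r [r] ≤ pathVal σ A n s [s])
    (hs : ¬ ∀ σ : Scheduler P, pathVal σ A n s [s] = 0) :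
    minVal P A n r [r] ≤ minVal P A n s [s] := by
  obtain ⟨σ₀, hσ₀⟩ := exists_pathVal_eq_minVal P A n s
  rcases eq_or_ne (minVal P A n s [s]) 0 with h0 | h0
  · push Not at hs
    obtain ⟨σ₁, hσ₁⟩ := hs
    by_contra hlt
    rw [h0, not_le] at hlt
    have hle1 : minVal P A n r [r] ≤ 1 := (isLowerEnvelope_minVal P n r).le_one A
    have htop : minVal P A n r [r] ≠ ⊤ := ne_top_of_le_ne_top ENNReal.one_ne_top hle1
    have hhalf := ENNReal.half_lt_self hlt.ne' htop
    let c := minVal P A n r [r] / 2 / (n + 1 : ℕ)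
    have hc0 : c ≠ 0 :=
      (ENNReal.div_pos (ENNReal.half_pos hlt.ne').ne' (ENNReal.natCast_ne_top _)).ne'
    have hnc : (n + 1 : ℕ) * c = minVal P A n r [r] / 2 :=
      ENNReal.mul_div_cancel (by simp) (ENNReal.natCast_ne_top _)
    have hc1 : c ≤ 1 := by
      refine le_trans ?_ (hhalf.le.trans hle1)
      rw [← hnc]
      refine le_mul_of_one_le_left zero_le ?_
      exact_mod_cast Nat.succ_le_succ (Nat.zero_le n)
    obtain ⟨σ', hσ'⟩ := h (σ₀.mix σ₁ c hc1) <| lt_of_lt_of_le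
      (ENNReal.mul_pos (pow_ne_zero n hc0) hσ₁)
      (pow_mul_pathVal_le_pathVal_mix σ₀ σ₁ c hc1 A n s [s])
    have hle : pathVal (σ₀.mix σ₁ c hc1) A n s [s] ≤ minVal P A n r [r] / 2 := by
      refine (pathVal_mix_le σ₀ σ₁ c hc1 A rfl).trans ?_
      rw [hσ₀, h0, zero_add, ← hnc]
      exact mul_le_mul_left (by exact_mod_cast Nat.le_succ n) c
    exact absurd (((minVal_le_pathVal σ' A rfl).trans hσ').trans hle) (not_le.2 hhalf)
  · obtain ⟨σ', hσ'⟩ := h σ₀ (by rw [hσ₀]; exact pos_iff_ne_zero.2 h0)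
    exact (minVal_le_pathVal σ' A rfl).trans (hσ'.trans hσ₀.le)

/-! ### Probabilities of sets of cones as path values -/

theorem tsum_list_eq_nil_add_cons (f : List S → ℝ≥0∞) :
    ∑' l, f l = f [] + ∑' t, ∑' l, f (t :: l) := by
  rw [ENNReal.tsum_eq_add_tsum_ite ([] : List S), ← ENNReal.tsum_prod]
  congr 1
  have hinj : Function.Injective fun p : S × List S => p.1 :: p.2 := by
    rintro ⟨a, l⟩ ⟨b, l'⟩ h
    simpa using h
  rw [← hinj.tsum_eq]
  · exact tsum_congr fun p => if_neg (List.cons_ne_nil _ _)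
  · intro l hl
    cases l with
    | nil => simp at hl
    | cons t l => exact ⟨(t, l), rfl⟩

/-- The set of all lists having a prefix in `A`. -/
def prefixHull (A : Set (List S)) : Set (List S) := {ω | ∃ ω', ω' <+: ω ∧ ω' ∈ A}

theorem tsum_coneW_minimal_of_mem (σ : Scheduler P) {A : Set (List S)} (n : ℕ) {s : S}
    {ω : List S} (hlast : ω.getLast? = some s) (hpre : ∀ ω', ω' <+: ω → ω' ≠ ω → ω' ∉ A)
    (hω : ω ∈ A) :
    ∑' l, (if ω ++ l ∈ A ∧ ∀ ω', ω' <+: ω ++ l → ω' ≠ ω ++ l → ω' ∉ A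
      then coneW P σ s ω l else 0) = pathVal σ (prefixHull A) n s ω := by
  have hull : ∀ l, ω ++ l ∈ prefixHull A := fun l => ⟨ω, List.prefix_append ω l, hω⟩
  rw [pathVal_eq_one σ hlast hull, tsum_eq_single []]
  · rw [if_pos ⟨by simpa using hω, by simpa using hpre⟩, coneW]
  · intro l hl
    refine if_neg fun h => h.2 ω (List.prefix_append ω l) ?_ hω
    simpa using hl

theorem tsum_coneW_minimal (σ : Scheduler P) {A : Set (List S)} {n : ℕ} {s : S} {ω : List S}
    (hlast : ω.getLast? = some s) (hpre : ∀ ω', ω' <+: ω → ω' ≠ ω → ω' ∉ A)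
    (hlen : ∀ ω' ∈ A, ω'.length ≤ ω.length + n) :
    ∑' l, (if ω ++ l ∈ A ∧ ∀ ω', ω' <+: ω ++ l → ω' ≠ ω ++ l → ω' ∉ A
      then coneW P σ s ω l else 0) = pathVal σ (prefixHull A) n s ω := by
  by_cases hω : ω ∈ A
  · exact tsum_coneW_minimal_of_mem σ n hlast hpre hω
  have hpre_mem : ∀ ω', ω' <+: ω → ω' ∉ A := by
    intro ω' h
    by_cases hE : ω' = ω
    · exact hE ▸ hω
    · exact hpre ω' h hE
  induction n generalizing s ω with
  | zero =>
    rw [pathVal, if_neg (fun ⟨ω', h, hA⟩ => hpre_mem ω' h hA), ENNReal.tsum_eq_zero]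
    intro l
    refine if_neg fun h => hω ?_
    have := hlen _ h.1
    have hl : l = [] := List.eq_nil_of_length_eq_zero (by simp at this; simp [this])
    simpa [hl] using h.1
  | succ n ih =>
    rw [tsum_list_eq_nil_add_cons, if_neg (fun h => hω (by simpa using h.1)), zero_add, pathVal]
    refine tsum_congr fun t => ?_
    have hpre' : ∀ ω', ω' <+: ω ++ [t] → ω' ≠ ω ++ [t] → ω' ∉ A := fun ω' h hne =>
      hpre_mem ω' ((List.prefix_concat_iff.1 h).resolve_left hne)
    have hstep : ∑' l, (if (ω ++ [t]) ++ l ∈ A ∧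
          ∀ ω', ω' <+: (ω ++ [t]) ++ l → ω' ≠ (ω ++ [t]) ++ l → ω' ∉ A
          then coneW P σ t (ω ++ [t]) l else 0) = pathVal σ (prefixHull A) n t (ω ++ [t]) := by
      by_cases ht : ω ++ [t] ∈ A
      · exact tsum_coneW_minimal_of_mem σ n (by simp) hpre' ht
      · refine ih (by simp) hpre' (fun ω' h => ?_) ht fun ω' h => ?_
        · have := hlen ω' h
          simp
          omega
        · by_cases hE : ω' = ω ++ [t]
          · exact hE ▸ ht
          · exact hpre' ω' h hE
    rw [← hstep, ← ENNReal.tsum_mul_left]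
    refine tsum_congr fun l => ?_
    simp only [List.append_assoc, List.singleton_append, mul_ite, mul_zero, coneW, stepProb]

theorem minCoverProb_eq_pathVal (σ : Scheduler P) {A : Set (List S)} {n : ℕ} (s : S)
    (hnil : [] ∉ A) (hlen : ∀ ω ∈ A, ω.length ≤ n + 1) :
    minCoverProb P σ s A = pathVal σ (prefixHull A) n s [s] := by
  rw [← tsum_coneW_minimal σ rfl ?_ (fun ω h => by have := hlen ω h; simp; omega)]
  · refine (tsum_subtype {ω : List S | ω ∈ A ∧ ∀ ω' : List S, ω' <+: ω → ω' ≠ ω → ω' ∉ A}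
      fun ω => if ω.head? = some s then coneWeight P σ ω else 0).trans ?_
    rw [tsum_list_eq_nil_add_cons]
    have h0 : Set.indicator {ω : List S | ω ∈ A ∧ ∀ ω' : List S, ω' <+: ω → ω' ≠ ω → ω' ∉ A}
        (fun ω => if ω.head? = some s then coneWeight P σ ω else 0) [] = 0 := by
      simp [coneWeight]
    rw [h0, zero_add, tsum_eq_single s]
    · refine tsum_congr fun l => ?_
      simp [Set.indicator, coneWeight]
    · intro t ht
      simp [Set.indicator, ht]
  · intro ω' h hne
    cases ω' with
    | nil => exact hnil
    | cons a l =>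
      obtain ⟨rfl, hl⟩ := List.cons_prefix_cons.1 h
      exact absurd (by rw [List.prefix_nil.1 hl]) hne

theorem coneSetProb_eq_pathVal {R : S → S → Prop} {Om : Set (List (Set S))} {n : ℕ}
    (hR : DCPathSet R Om) (hlen : ∀ Ω ∈ Om, Ω.length ≤ n + 1) (σ : Scheduler P) (s : S) :
    coneSetProb P σ s Om = pathVal σ (prefixHull {ω | MatchSet ω Om}) n s [s] := by
  refine minCoverProb_eq_pathVal σ s ?_ ?_
  · rintro ⟨Ω, hΩ, h⟩
    exact (hR Ω hΩ).1 (List.forall₂_nil_left_iff.1 h)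
  · rintro ω ⟨Ω, hΩ, h⟩
    exact (List.Forall₂.length_eq h).trans_le (hlen Ω hΩ)

/-- The sets of finite paths that are invariant under replacing states by `E`-related ones. -/
def pathClosed (E : S → S → Prop) : Set (Set (List S)) :=
  {A | ∀ ω ∈ A, ∀ ω', List.Forall₂ E ω ω' → ω' ∈ A}

theorem compl_mem_pathClosed {E : S → S → Prop} (hE : Equivalence E) {A : Set (List S)}
    (hA : A ∈ pathClosed E) : Aᶜ ∈ pathClosed E := fun ω hω ω' h hω' =>
  hω (hA ω' hω' ω (List.Forall₂.imp (fun _ _ => hE.symm) h.flip))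

theorem inter_mem_pathClosed {E : S → S → Prop} {A B : Set (List S)}
    (hA : A ∈ pathClosed E) (hB : B ∈ pathClosed E) : A ∩ B ∈ pathClosed E :=
  fun ω hω ω' h => ⟨hA ω hω.1 ω' h, hB ω hω.2 ω' h⟩

theorem DownClosed.mem_of_rel {E : S → S → Prop} {C : Set S} (hC : DownClosed E C) {s t : S}
    (hs : s ∈ C) (h : E t s) : t ∈ C := by
  rw [DownClosed] at hC
  rw [hC]
  exact ⟨s, hs, h⟩

theorem prefixHull_matchSet_mem_pathClosed {E : S → S → Prop} (hE : Equivalence E)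
    {Om : Set (List (Set S))} (hOm : DCPathSet E Om) :
    prefixHull {ω | MatchSet ω Om} ∈ pathClosed E := by
  rintro ω ⟨ω₁, hpre, Ω, hΩ, hm⟩ ω' h
  rw [List.prefix_iff_eq_take] at hpre
  have h1 : List.Forall₂ E ω₁ (ω'.take ω₁.length) := by
    have := List.forall₂_take ω₁.length h
    rwa [← hpre] at this
  refine ⟨ω'.take ω₁.length, List.take_prefix _ _, Ω, hΩ, ?_⟩
  have hC := (hOm Ω hΩ).2
  have hm' : List.Forall₂ (· ∈ ·) ω₁ Ω := hm
  show List.Forall₂ (· ∈ ·) _ Ω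
  generalize ω'.take ω₁.length = ω₂ at h1
  clear hm hpre hΩ h
  induction h1 generalizing Ω with
  | nil => exact hm'
  | cons hab _ ih =>
    cases hm' with
    | cons hmem htl =>
      exact .cons ((hC _ List.mem_cons_self).mem_of_rel hmem (hE.symm hab))
        (ih _ (fun C h => hC C (List.mem_cons_of_mem _ h)) htl)

/-- Every invariant set of paths is described by a set of downward closed paths. -/
theorem exists_coneSetProb_eq_pathVal (P : PA S AP) {E : S → S → Prop} (hE : Equivalence E)
    {A : Set (List S)} (hA : A ∈ pathClosed E) (n : ℕ) :
    ∃ Om, DCPathSet E Om ∧ (∀ Ω ∈ Om, Ω.length ≤ n + 1) ∧ (∃ Ω ∈ Om, Ω.length = n + 1) ∧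
      ∀ (σ : Scheduler P) (s : S), coneSetProb P σ s Om = pathVal σ A n s [s] := by
  let cls (t : S) : Set S := {t' | E t t'}
  let Om : Set (List (Set S)) := {Ω | Ω = List.replicate (n + 1) ∅ ∨
    ∃ ω ∈ A, ω.length = n + 1 ∧ Ω = ω.map cls}
  have hlen : ∀ Ω ∈ Om, Ω.length = n + 1 := by
    rintro Ω (rfl | ⟨ω, _, hω, rfl⟩)
    · simp
    · simpa using hω
  have hDC : DCPathSet E Om := by
    refine fun Ω hΩ => ⟨fun h => by simpa [h] using hlen Ω hΩ, fun C hC => ?_⟩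
    rcases hΩ with rfl | ⟨ω, _, _, rfl⟩
    · rw [List.eq_of_mem_replicate hC]
      simp [DownClosed]
    · obtain ⟨t, _, rfl⟩ := List.mem_map.1 hC
      ext u
      exact ⟨fun h => ⟨u, h, hE.refl u⟩, fun ⟨v, hv, huv⟩ => hE.trans hv (hE.symm huv)⟩
  have hmatch : ∀ ω : List S, MatchSet ω Om ↔ ω ∈ A ∧ ω.length = n + 1 := by
    intro ω
    constructor
    · rintro ⟨Ω, hΩ, hm⟩
      refine ⟨?_, (List.Forall₂.length_eq hm).trans (hlen Ω hΩ)⟩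
      rcases hΩ with rfl | ⟨ω', hω', _, rfl⟩
      · cases hm with
        | cons h _ => exact absurd h (Set.notMem_empty _)
      · exact hA ω' hω' ω (List.forall₂_map_right_iff.1 hm).flip
    · rintro ⟨hω, hl⟩
      refine ⟨ω.map cls, Or.inr ⟨ω, hω, hl, rfl⟩, List.forall₂_map_right_iff.2 ?_⟩
      exact List.forall₂_same.2 fun t _ => hE.refl t
  refine ⟨Om, hDC, fun Ω hΩ => (hlen Ω hΩ).le, ⟨_, Or.inl rfl, by simp⟩, fun σ s => ?_⟩
  rw [coneSetProb_eq_pathVal hDC (fun Ω hΩ => (hlen Ω hΩ).le)]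
  refine pathVal_congr σ fun l hl => ⟨?_, fun h => ⟨_, List.prefix_rfl, ?_⟩⟩
  · rintro ⟨ω, hpre, hω⟩
    obtain ⟨hωA, hωl⟩ := (hmatch ω).1 hω
    rwa [← hpre.eq_of_length (by simp [hωl, hl])]
  · exact (hmatch _).2 ⟨h, by simp [hl]⟩

/-! ### The equivalence of states induced by an equivalence of paths -/

/-- `s` and `r` have the same minimal probabilities for all `E`-invariant sets of paths with `n`
steps, or these minimal probabilities are zero-one valued for both. -/
def MinValEquiv (P : PA S AP) (E : S → S → Prop) (n : ℕ) (s r : S) : Prop :=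
  (∀ A ∈ pathClosed E, minVal P A n s [s] = minVal P A n r [r]) ∨
    (IsZeroOne (pathClosed E) (fun A => minVal P A n s [s]) ∧
      IsZeroOne (pathClosed E) (fun A => minVal P A n r [r]))

theorem minValEquiv_equivalence (P : PA S AP) {E : S → S → Prop} (hE : Equivalence E) (n : ℕ) :
    Equivalence (MinValEquiv P E n) := by
  have hcongr : ∀ s r, (∀ A ∈ pathClosed E, minVal P A n s [s] = minVal P A n r [r]) →
      IsZeroOne (pathClosed E) (fun A => minVal P A n s [s]) →
      IsZeroOne (pathClosed E) (fun A => minVal P A n r [r]) := by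
    intro s r h hs C hC
    have := hs C hC
    simpa only [h C hC, h _ (compl_mem_pathClosed hE hC)] using this
  refine ⟨fun s => Or.inl fun _ _ => rfl, ?_, ?_⟩
  · rintro s r (h | h)
    · exact Or.inl fun A hA => (h A hA).symm
    · exact Or.inr h.symm
  · rintro s r q (h | h) (h' | h')
    · exact Or.inl fun A hA => (h A hA).trans (h' A hA)
    · exact Or.inr ⟨hcongr r s (fun A hA => (h A hA).symm) h'.1, h'.2⟩
    · exact Or.inr ⟨h.1, hcongr r q h' h.2⟩
    · exact Or.inr ⟨h.1, h'.2⟩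

theorem MinValEquiv.exists_pathVal_le {E : S → S → Prop} {n : ℕ} {s r : S}
    (h : MinValEquiv P E n s r) {A : Set (List S)} (hA : A ∈ pathClosed E) (σ : Scheduler P)
    (hσ : 0 < pathVal σ A n s [s]) :
    ∃ σ' : Scheduler P, pathVal σ' A n r [r] ≤ pathVal σ A n s [s] := by
  obtain ⟨σ', hσ'⟩ := exists_pathVal_eq_minVal P A n r
  refine ⟨σ', ?_⟩
  rcases h with h | ⟨h, -⟩
  · rw [hσ', ← h A hA]
    exact minVal_le_pathVal σ A rfl
  · rcases h A hA with h1 | h1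
    · exact ((isLowerEnvelope_minVal P n r).apply_le_one σ' A).trans
        (h1 ▸ minVal_le_pathVal σ A rfl)
    · exact absurd ((isLowerEnvelope_minVal P n s).compl_eq_one_iff.1 h1 σ) (ne_of_gt hσ)

/-- Each positive probability of the cones of `Om` at one of the states `s`, `r` bounds some
probability at the other state from above. -/
def ConesCompatible (P : PA S AP) (Om : Set (List (Set S))) (s r : S) : Prop :=
  (∀ σ : Scheduler P, 0 < coneSetProb P σ s Om →
    ∃ σ' : Scheduler P, coneSetProb P σ' r Om ≤ coneSetProb P σ s Om) ∧
  (∀ σ : Scheduler P, 0 < coneSetProb P σ r Om →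
    ∃ σ' : Scheduler P, coneSetProb P σ' s Om ≤ coneSetProb P σ r Om)

theorem MinValEquiv.conesCompatible {E : S → S → Prop} (hE : Equivalence E) {n : ℕ} {s r : S}
    (h : MinValEquiv P E n s r) {Om : Set (List (Set S))} (hOm : DCPathSet E Om)
    (hlen : ∀ Ω ∈ Om, Ω.length ≤ n + 1) : ConesCompatible P Om s r := by
  have hA := prefixHull_matchSet_mem_pathClosed hE hOm
  simp only [ConesCompatible, coneSetProb_eq_pathVal hOm hlen]
  exact ⟨h.exists_pathVal_le hA, ((minValEquiv_equivalence P hE n).symm h).exists_pathVal_le hA⟩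

theorem minValEquiv_of_conesCompatible {E : S → S → Prop} (hE : Equivalence E) {n : ℕ} {s r : S}
    (h : ∀ Om, DCPathSet E Om → (∀ Ω ∈ Om, Ω.length ≤ n + 1) → (∃ Ω ∈ Om, Ω.length = n + 1) →
      ConesCompatible P Om s r) : MinValEquiv P E n s r := by
  refine (isLowerEnvelope_minVal P n s).eq_or_isZeroOne (isLowerEnvelope_minVal P n r)
    (fun A => compl_mem_pathClosed hE) (fun A hA B hB => inter_mem_pathClosed hA hB) ?_
  intro A hA
  obtain ⟨Om, hDC, hle, hex, hval⟩ := exists_coneSetProb_eq_pathVal P hE hA n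
  obtain ⟨h1, h2⟩ := h Om hDC hle hex
  simp only [hval] at h1 h2
  by_cases hs : ∀ σ : Scheduler P, pathVal σ A n s [s] = 0
  · exact Or.inl hs
  by_cases hr : ∀ σ : Scheduler P, pathVal σ A n r [r] = 0
  · exact Or.inr (Or.inl hr)
  exact Or.inr (Or.inr (le_antisymm (minVal_le_minVal_of_forall_pos h2 hr)
    (minVal_le_minVal_of_forall_pos h1 hs)))

theorem MinValEquiv.exists_distProb_le {E : S → S → Prop} (hE : Equivalence E) {s r : S}
    (h : MinValEquiv P E 1 s r) {C : Set S} (hC : DownClosed E C) {μ : PMF S}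
    (hμ : μ ∈ P.trans s) (hpos : 0 < distProb (⇑μ) C) :
    ∃ μ' ∈ P.trans r, distProb (⇑μ') C ≤ distProb (⇑μ) C := by
  let A : Set (List S) := {ω | ∃ a, ∃ b ∈ C, ω = [a, b]}
  have hA : A ∈ pathClosed E := by
    rintro _ ⟨a, b, hb, rfl⟩ ω' hω'
    obtain ⟨a', l, _, hl, rfl⟩ := List.forall₂_cons_left_iff.1 hω'
    obtain ⟨b', l', hbb', hl', rfl⟩ := List.forall₂_cons_left_iff.1 hl
    rw [List.forall₂_nil_left_iff.1 hl']
    exact ⟨a', b', hC.mem_of_rel hb (hE.symm hbb'), rfl⟩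
  have hmem : ∀ a b, [a] ++ [b] ∈ A ↔ b ∈ C := by simp [A]
  have hdist : ∀ (ν : PMF S) (a : S),
      ∑' t, ν t * (if [a] ++ [t] ∈ A then 1 else 0) = distProb (⇑ν) C := by
    intro ν a
    refine tsum_congr fun t => ?_
    simp only [hmem, Set.indicator, mul_ite, mul_one, mul_zero]
  choose f hf using P.nonempty_trans
  obtain ⟨σ, hσ⟩ := exists_scheduler_of_choice P s (fun _ u => if u = s then μ else f u)
    (fun _ u => by split_ifs with hu <;> [exact hu ▸ hμ; exact hf u])
  have hval : pathVal σ A 1 s [s] = distProb (⇑μ) C := by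
    rw [← hdist μ s]
    refine tsum_congr fun t => ?_
    rw [hσ [s] s rfl t, if_pos rfl]
    rfl
  obtain ⟨σ', hσ'⟩ := h.exists_pathVal_le hA σ (hval ▸ hpos)
  obtain ⟨μ', hμ', hmin⟩ := Set.exists_min_image _ (fun ν : PMF S => distProb (⇑ν) C)
    (P.image_finite r) (P.nonempty_trans r)
  refine ⟨μ', hμ', le_trans ?_ (((minVal_le_pathVal σ' A rfl).trans hσ').trans hval.le)⟩
  refine le_iInf₂ fun ν hν => (hmin ν hν).trans ?_
  rw [← hdist ν r]
  exact le_rfl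

/-! ### Strong depth bisimilarities -/

/-- `R` is a strong `(i + 2)`-depth bisimulation. -/
def IsDepthBisim (P : PA S AP) (i : ℕ) (R : S → S → Prop) : Prop :=
  ((∀ s, R s s) ∧ (∀ ⦃s r q⦄, R s r → R r q → R s q) ∧
    ∀ s r, R s r → SBisim P (i + 1) s r ∧
      ∀ Om : Set (List (Set S)), DCPathSet R Om →
        (∀ Ω ∈ Om, Ω.length ≤ i + 2) → (∃ Ω ∈ Om, Ω.length = i + 2) → ConesCompatible P Om s r)

theorem sBisim_add_two_iff {i : ℕ} {s r : S} :
    SBisim P (i + 2) s r ↔ ∃ R, IsDepthBisim P i R ∧ R s r := Iff.rfl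

theorem sBisim_of_succ {i : ℕ} {s r : S} (h : SBisim P (i + 2) s r) : SBisim P (i + 1) s r := by
  obtain ⟨R, hR, hsr⟩ := sBisim_add_two_iff.1 h
  exact (hR.2.2 s r hsr).1

theorem sBisim_antitone {i j : ℕ} (hi : 1 ≤ i) (hij : i ≤ j) {s r : S} (h : SBisim P j s r) :
    SBisim P i s r := by
  induction j, hij using Nat.le_induction with
  | base => exact h
  | succ j hj ih =>
    obtain ⟨k, rfl⟩ : ∃ k, j = k + 1 := ⟨j - 1, by omega⟩
    exact ih (sBisim_of_succ h)

theorem sBisim_one_label {s r : S} (h : SBisim P 1 s r) : P.label s = P.label r := by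
  obtain ⟨R, hR, hsr⟩ : S1Bisim P s r := h
  exact (hR.2.2 s r hsr).1

theorem sBisim_refl (P : PA S AP) (i : ℕ) (s : S) : SBisim P i s s := by
  match i with
  | 0 => trivial
  | 1 =>
    refine ⟨Eq, ⟨fun _ => rfl, fun _ _ _ => Eq.trans, ?_⟩, rfl⟩
    rintro s _ rfl
    exact ⟨rfl, fun C _ => ⟨fun μ hμ _ => ⟨μ, hμ, le_rfl⟩, fun μ hμ _ => ⟨μ, hμ, le_rfl⟩⟩⟩
  | i + 2 =>
    refine sBisim_add_two_iff.2 ⟨Eq, ⟨fun _ => rfl, fun _ _ _ => Eq.trans, ?_⟩, rfl⟩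
    rintro s _ rfl
    exact ⟨sBisim_refl P (i + 1) s,
      fun _ _ _ _ => ⟨fun σ _ => ⟨σ, le_rfl⟩, fun σ _ => ⟨σ, le_rfl⟩⟩⟩

theorem DownClosed.of_le {R E : S → S → Prop} {C : Set S} (hC : DownClosed E C)
    (hR : ∀ s, R s s) (hRE : ∀ s r, R s r → E s r) : DownClosed R C :=
  Set.Subset.antisymm (fun s hs => ⟨s, hs, hR s⟩)
    fun _ ⟨_, hr, hsr⟩ => hC.mem_of_rel hr (hRE _ _ hsr)

/-- Related states have equivalent minimal path probabilities with respect to the equivalence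
generated by the bisimilarity. -/
theorem minValEquiv_of_eqvGen {i : ℕ} {s r : S}
    (h : Relation.EqvGen (SBisim P (i + 2)) s r) :
    MinValEquiv P (Relation.EqvGen (SBisim P (i + 2))) (i + 1) s r := by
  have hE := Relation.EqvGen.is_equivalence (SBisim P (i + 2))
  refine (minValEquiv_equivalence P hE (i + 1)).eqvGen_iff.1 (h.mono fun a b hab => ?_)
  obtain ⟨R, hR, hRab⟩ := sBisim_add_two_iff.1 hab
  refine minValEquiv_of_conesCompatible hE fun Om hOm hle hex =>
    (hR.2.2 a b hRab).2 Om (fun Ω hΩ => ⟨(hOm Ω hΩ).1, fun C hC => ?_⟩) hle hex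
  exact ((hOm Ω hΩ).2 C hC).of_le hR.1 fun u v huv =>
    .rel u v (sBisim_add_two_iff.2 ⟨R, hR, huv⟩)

/-- The equivalence generated by `∼²` is a strong 1-depth bisimulation. -/
theorem isS1B_eqvGen (P : PA S AP) : IsS1B P (Relation.EqvGen (SBisim P 2)) := by
  have hE := Relation.EqvGen.is_equivalence (SBisim P 2)
  refine ⟨hE.refl, fun _ _ _ => hE.trans, fun s r h => ⟨?_, fun C hC => ⟨?_, ?_⟩⟩⟩
  · have hlabel : Equivalence fun a b => P.label a = P.label b :=
      ⟨fun _ => rfl, Eq.symm, Eq.trans⟩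
    exact hlabel.eqvGen_iff.1 (h.mono fun a b hab => sBisim_one_label (sBisim_of_succ hab))
  · exact fun μ => (minValEquiv_of_eqvGen h).exists_distProb_le hE hC
  · exact fun μ => (minValEquiv_of_eqvGen (hE.symm h)).exists_distProb_le hE hC

theorem sBisim_equivalence (P : PA S AP) (i : ℕ) : Equivalence (SBisim P (i + 2)) := by
  have hE := Relation.EqvGen.is_equivalence (SBisim P (i + 2))
  have hprev : ∀ s r, Relation.EqvGen (SBisim P (i + 2)) s r → SBisim P (i + 1) s r := by
    intro s r h
    match i with
    | 0 => exact ⟨_, isS1B_eqvGen P, h⟩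
    | i + 1 =>
      exact (sBisim_equivalence P i).eqvGen_iff.1 (h.mono fun a b => sBisim_of_succ)
  have hbisim : IsDepthBisim P i (Relation.EqvGen (SBisim P (i + 2))) :=
    ⟨hE.refl, fun _ _ _ => hE.trans, fun s r h => ⟨hprev s r h, fun Om hOm hle _ =>
      (minValEquiv_of_eqvGen h).conesCompatible hE hOm hle⟩⟩
  have hle : ∀ s r, Relation.EqvGen (SBisim P (i + 2)) s r → SBisim P (i + 2) s r :=
    fun s r h => sBisim_add_two_iff.2 ⟨_, hbisim, h⟩
  exact ⟨sBisim_refl P (i + 2), fun h => hle _ _ (hE.symm (.rel _ _ h)),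
    fun h h' => hle _ _ (hE.trans (.rel _ _ h) (.rel _ _ h'))⟩

theorem sBisim_stabilizes [Finite S] (P : PA S AP) :
    ∃ i : ℕ, 1 ≤ i ∧ ∀ j k : ℕ, i ≤ j → i ≤ k → SBisim P j = SBisim P k := by
  let f : ℕ →o (S → S → Prop)ᵒᵈ :=
    ⟨fun n => OrderDual.toDual (SBisim P (n + 1)), fun m n hmn _ _ h =>
      sBisim_antitone (by omega) (Nat.succ_le_succ hmn) h⟩
  obtain ⟨N, hN⟩ := WellFoundedGT.monotone_chain_condition f
  have hstab : ∀ j, N + 1 ≤ j → SBisim P j = SBisim P (N + 1) := by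
    intro j hj
    obtain ⟨k, rfl⟩ : ∃ k, j = k + 1 := ⟨j - 1, by omega⟩
    exact (OrderDual.toDual.injective (hN k (by omega))).symm
  exact ⟨N + 1, by omega, fun j k hj hk => (hstab j hj).trans (hstab k hk).symm⟩

/-- properties of the strong `i`-depth bisimilarities. -/
theorem sbisim_equivalence_antitone_stabilizes
    (S AP : Type) [Finite S] (P : PA S AP) :
    -- (1) ∼ⁱ (i > 1) is an equivalence relation
    (∀ i : ℕ, 1 < i → Equivalence (SBisim P i)) ∧
    -- (2) ∼ʲ ⊆ ∼ⁱ for 1 ≤ i ≤ j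
    (∀ i j : ℕ, 1 ≤ i → i ≤ j → ∀ s r : S, SBisim P j s r → SBisim P i s r) ∧
    -- (3) the sequence stabilizes
    (∃ i : ℕ, 1 ≤ i ∧ ∀ j k : ℕ, i ≤ j → i ≤ k → SBisim P j = SBisim P k) := by
  refine ⟨fun i hi => ?_, fun i j hi hij s r => sBisim_antitone hi hij, sBisim_stabilizes P⟩
  obtain ⟨k, rfl⟩ : ∃ k, i = k + 2 := ⟨i - 2, by omega⟩
  exact sBisim_equivalence P k

end
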